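/- The compact set 𝓢 is forward flow-invariant for the Einstein vector field: if c : I → ℝ⁶ is a solution of c'(η) = V(c(η)) on an interval I, η₀, η₁ ∈ I with η₀ ≤ η₁, and c(η₀) ∈ 𝓢, then c(η₁) ∈ 𝓢. -/

import Mathlib

open Real Set Filter

noncomputable section

/-- The quadratic form `G(p) = X₁² + 2X₂² + 4m X₃²`. -/
def G (m : ℕ) (p : Fin 6 → ℝ) : ℝ := (p 0)^2 + 2*(p 1)^2 + 4*(m:ℝ)*(p 2)^2

/-- `R₁(p) = (1/2)Y₁²Y₂² + (m/4)Y₁²Y₃²`. -/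
def R1 (m : ℕ) (p : Fin 6 → ℝ) : ℝ := (1/2)*(p 3)^2*(p 4)^2 + ((m:ℝ)/4)*(p 3)^2*(p 5)^2

/-- `R₂(p) = 2Y₂² − (1/2)Y₁²Y₂² + (m/2)Y₃²`. -/
def R2 (m : ℕ) (p : Fin 6 → ℝ) : ℝ := 2*(p 4)^2 - (1/2)*(p 3)^2*(p 4)^2 + ((m:ℝ)/2)*(p 5)^2

/-- `R₃(p) = (m+2)Y₂Y₃ − (1/8)Y₁²Y₃² − (1/2)Y₃²`. -/
def R3 (m : ℕ) (p : Fin 6 → ℝ) : ℝ :=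
  ((m:ℝ)+2)*(p 4)*(p 5) - (1/8)*(p 3)^2*(p 5)^2 - (1/2)*(p 5)^2

/-- `R_s = R₁ + 2R₂ + 4m R₃`. -/
def Rs (m : ℕ) (p : Fin 6 → ℝ) : ℝ := R1 m p + 2*R2 m p + 4*(m:ℝ)*R3 m p

/-- `L = (G + R_s − 1)/(4m+2)`. -/
def L (m : ℕ) (p : Fin 6 → ℝ) : ℝ := (G m p + Rs m p - 1)/(4*(m:ℝ)+2)

/-- The Einstein vector field. -/
def V (m : ℕ) (p : Fin 6 → ℝ) : Fin 6 → ℝ :=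
  ![ p 0 * (G m p + L m p - 1) + R1 m p - L m p,
     p 1 * (G m p + L m p - 1) + R2 m p - L m p,
     p 2 * (G m p + L m p - 1) + R3 m p - L m p,
     p 3 * (p 0 - p 1),
     p 4 * (G m p + L m p - p 1),
     p 5 * (G m p + L m p + p 1 - 2*p 2) ]

/-- `𝓔 = {p : X₁+2X₂+4m X₃ = 1 and G + R_s ≤ 1}`. -/
def setE (m : ℕ) : Set (Fin 6 → ℝ) :=
  {p | p 0 + 2*p 1 + 4*(m:ℝ)*p 2 = 1 ∧ G m p + Rs m p ≤ 1}

/-- `∂𝓔 = {p : X₁+2X₂+4m X₃ = 1 and G + R_s = 1}`. -/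
def bdryE (m : ℕ) : Set (Fin 6 → ℝ) :=
  {p | p 0 + 2*p 1 + 4*(m:ℝ)*p 2 = 1 ∧ G m p + Rs m p = 1}

/-- `𝓟 = {p : Y₁ ≥ 0, Y₂ ≥ 0, Y₃ ≥ 0}`. -/
def setP : Set (Fin 6 → ℝ) := {p | 0 ≤ p 3 ∧ 0 ≤ p 4 ∧ 0 ≤ p 5}

/-- `𝓐₁ = {p : X₁ ≤ X₂ and Y₁² ≤ 2}`. -/
def setA1 : Set (Fin 6 → ℝ) := {p | p 0 ≤ p 1 ∧ (p 3)^2 ≤ 2}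

/-- `𝓐₂`. -/
def setA2 : Set (Fin 6 → ℝ) :=
  {p | 0 ≤ 2*p 4 - p 5 ∧ 0 ≤ (Real.sqrt 2/2)*(2*p 4 - p 5) + p 2 - p 1 ∧
       p 1 ≤ 1/2 ∧ 0 ≤ p 2}

/-- The compact invariant set `𝓢`. -/
def setS (m : ℕ) : Set (Fin 6 → ℝ) := setE m ∩ setP ∩ setA1 ∩ setA2

/-- A solution of the Einstein ODE system on a set `I ⊆ ℝ`. -/
def IsSolution (m : ℕ) (I : Set ℝ) (c : ℝ → Fin 6 → ℝ) : Prop :=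
  ∀ η ∈ I, HasDerivWithinAt c (V m (c η)) I η

theorem hasDerivAt_sq_min_zero (x : ℝ) :
    HasDerivAt (fun y : ℝ => (min y 0) ^ 2) (2 * min x 0) x := by
  rcases lt_trichotomy x 0 with hx | rfl | hx
  · rw [min_eq_left hx.le]
    have h : HasDerivAt (fun y : ℝ => y ^ 2) (2 * x) x := by
      simpa using hasDerivAt_pow 2 x
    refine h.congr_of_eventuallyEq ?_
    filter_upwards [Iio_mem_nhds hx] with y hy
    rw [min_eq_left (le_of_lt hy)]
  · rw [hasDerivAt_iff_isLittleO]
    have h : (fun y : ℝ => y ^ 2) =o[nhds 0] fun y : ℝ => y :=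
      Asymptotics.isLittleO_pow_id one_lt_two
    refine (Asymptotics.IsBigO.of_bound 1 ?_).trans_isLittleO (by simpa using h)
    refine Eventually.of_forall fun y => ?_
    rcases le_total y 0 with hy | hy <;> simp [hy]
  · rw [min_eq_right hx.le, mul_zero]
    refine (hasDerivAt_const x (0 : ℝ)).congr_of_eventuallyEq ?_
    filter_upwards [Ioi_mem_nhds hx] with y hy
    rw [min_eq_right (le_of_lt hy)]
    norm_num

/-- A function with `φ' ≤ K φ` and `φ a ≤ 0` stays nonpositive. -/
theorem nonpos_of_deriv_le_mul {a b K : ℝ} {φ φ' : ℝ → ℝ}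
    (hφ : ∀ t ∈ Icc a b, HasDerivWithinAt φ (φ' t) (Icc a b) t)
    (hle : ∀ t ∈ Icc a b, φ' t ≤ K * φ t) (ha : φ a ≤ 0) :
    ∀ t ∈ Icc a b, φ t ≤ 0 := by
  have hψ : ∀ t ∈ Icc a b, HasDerivWithinAt (fun s => φ s * exp (-K * s))
      (φ' t * exp (-K * t) + φ t * (exp (-K * t) * (-K))) (Icc a b) t := by
    intro t ht
    have he : HasDerivAt (fun s => exp (-K * s)) (exp (-K * t) * (-K)) t := by
      simpa using ((hasDerivAt_id t).const_mul (-K)).exp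
    exact (hφ t ht).mul he.hasDerivWithinAt
  have hanti : AntitoneOn (fun s => φ s * exp (-K * s)) (Icc a b) := by
    refine antitoneOn_of_hasDerivWithinAt_nonpos (convex_Icc a b)
      (fun t ht => (hψ t ht).continuousWithinAt)
      (fun t ht => (hψ t (interior_subset ht)).mono interior_subset) ?_
    intro t ht
    have h1 := hle t (interior_subset ht)
    have h2 := exp_pos (-K * t)
    nlinarith
  intro t ht
  have h := hanti (left_mem_Icc.2 (ht.1.trans ht.2)) ht ht.1
  have h1 := exp_pos (-K * a)
  have h2 := exp_pos (-K * t)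
  by_contra! hpos
  have h3 : φ t * exp (-K * t) ≤ φ a * exp (-K * a) := h
  nlinarith [mul_pos hpos h2, mul_nonneg (neg_nonneg.2 ha) h1.le]

theorem mul_min_zero_le {K α β f g f' : ℝ} (hα : |α| ≤ K) (hβ : |β| ≤ K)
    (h : α * f + β * g ≤ f') (hβg : 0 ≤ g → 0 ≤ β * g) :
    2 * min f 0 * f' ≤ 3 * K * ((min f 0) ^ 2 + (min g 0) ^ 2) := by
  have hK : 0 ≤ K := (abs_nonneg α).trans hα
  obtain ⟨hα1, hα2⟩ := abs_le.1 hα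
  obtain ⟨hβ1, hβ2⟩ := abs_le.1 hβ
  rcases le_or_gt 0 f with hf | hf
  · rw [min_eq_right hf]
    have : 0 ≤ 3 * K * (0 ^ 2 + (min g 0) ^ 2) := by positivity
    linarith
  · rw [min_eq_left hf.le]
    have h1 : f * f' ≤ f * (α * f + β * g) := mul_le_mul_of_nonpos_left h hf.le
    have h2 : α * f ^ 2 ≤ K * f ^ 2 := mul_le_mul_of_nonneg_right hα2 (sq_nonneg f)
    rcases le_or_gt 0 g with hg | hg
    · rw [min_eq_right hg]
      have h3 : f * (β * g) ≤ 0 := mul_nonpos_of_nonpos_of_nonneg hf.le (hβg hg)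
      nlinarith [mul_nonneg hK (sq_nonneg f)]
    · rw [min_eq_left hg.le]
      have h3 : β * (f * g) ≤ K * (f * g) :=
        mul_le_mul_of_nonneg_right hβ2 (mul_nonneg_of_nonpos_of_nonpos hf.le hg.le)
      nlinarith [mul_nonneg hK (sq_nonneg f), mul_nonneg hK (sq_nonneg g),
        mul_nonneg hK (sq_nonneg (f - g))]

/-- The quadrant is invariant under a cooperative planar system. The coupling coefficient `γ`
only has to be nonnegative where `f` is. -/
theorem nonneg_of_cooperative {a b : ℝ} {f g f' g' α β γ δ : ℝ → ℝ}
    (hf : ∀ t ∈ Icc a b, HasDerivWithinAt f (f' t) (Icc a b) t)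
    (hg : ∀ t ∈ Icc a b, HasDerivWithinAt g (g' t) (Icc a b) t)
    (hα : ContinuousOn α (Icc a b)) (hβ : ContinuousOn β (Icc a b))
    (hγ : ContinuousOn γ (Icc a b)) (hδ : ContinuousOn δ (Icc a b))
    (hβ0 : ∀ t ∈ Icc a b, 0 ≤ β t) (hγ0 : ∀ t ∈ Icc a b, 0 ≤ f t → 0 ≤ γ t)
    (hf' : ∀ t ∈ Icc a b, α t * f t + β t * g t ≤ f' t)
    (hg' : ∀ t ∈ Icc a b, γ t * f t + δ t * g t ≤ g' t)
    (hfa : 0 ≤ f a) (hga : 0 ≤ g a) :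
    ∀ t ∈ Icc a b, 0 ≤ f t ∧ 0 ≤ g t := by
  obtain ⟨Kα, hKα⟩ := isCompact_Icc.exists_bound_of_continuousOn hα
  obtain ⟨Kβ, hKβ⟩ := isCompact_Icc.exists_bound_of_continuousOn hβ
  obtain ⟨Kγ, hKγ⟩ := isCompact_Icc.exists_bound_of_continuousOn hγ
  obtain ⟨Kδ, hKδ⟩ := isCompact_Icc.exists_bound_of_continuousOn hδ
  simp only [Real.norm_eq_abs] at hKα hKβ hKγ hKδ
  set K := max (max Kα Kβ) (max Kγ Kδ)
  have hαK : Kα ≤ K := (le_max_left _ _).trans (le_max_left _ _)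
  have hβK : Kβ ≤ K := (le_max_right _ _).trans (le_max_left _ _)
  have hγK : Kγ ≤ K := (le_max_left _ _).trans (le_max_right _ _)
  have hδK : Kδ ≤ K := (le_max_right _ _).trans (le_max_right _ _)
  have key := nonpos_of_deriv_le_mul (a := a) (b := b) (K := 6 * K)
    (φ := fun t => (min (f t) 0) ^ 2 + (min (g t) 0) ^ 2)
    (φ' := fun t => 2 * min (f t) 0 * f' t + 2 * min (g t) 0 * g' t)
    (fun t ht => ((hasDerivAt_sq_min_zero (f t)).comp_hasDerivWithinAt t (hf t ht)).add
      ((hasDerivAt_sq_min_zero (g t)).comp_hasDerivWithinAt t (hg t ht)))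
    (by
      intro t ht
      have h1 := mul_min_zero_le ((hKα t ht).trans hαK) ((hKβ t ht).trans hβK) (hf' t ht)
        (fun h => mul_nonneg (hβ0 t ht) h)
      have h2 := mul_min_zero_le ((hKδ t ht).trans hδK) ((hKγ t ht).trans hγK)
        ((add_comm _ _).trans_le (hg' t ht))
        (fun h => mul_nonneg (hγ0 t ht h) h)
      linarith)
    (by simp [hfa, hga])
  intro t ht
  have h := key t ht
  have h1 : min (f t) 0 = 0 := by nlinarith [sq_nonneg (min (f t) 0), sq_nonneg (min (g t) 0)]
  have h2 : min (g t) 0 = 0 := by nlinarith [sq_nonneg (min (f t) 0), sq_nonneg (min (g t) 0)]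
  exact ⟨min_eq_right_iff.1 h1, min_eq_right_iff.1 h2⟩

theorem nonneg_of_mul_le_deriv {a b : ℝ} {f f' α : ℝ → ℝ}
    (hf : ∀ t ∈ Icc a b, HasDerivWithinAt f (f' t) (Icc a b) t)
    (hα : ContinuousOn α (Icc a b))
    (hf' : ∀ t ∈ Icc a b, α t * f t ≤ f' t) (hfa : 0 ≤ f a) :
    ∀ t ∈ Icc a b, 0 ≤ f t := fun t ht =>
  (nonneg_of_cooperative hf hf hα continuousOn_const continuousOn_const hα
    (β := fun _ => 0) (γ := fun _ => 0) (fun _ _ => le_rfl) (fun _ _ _ => le_rfl)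
    (by simpa using hf') (by simpa using hf') hfa hfa t ht).1

theorem continuous_G (m : ℕ) : Continuous (G m) := by
  unfold G; fun_prop

theorem continuous_L (m : ℕ) : Continuous (L m) := by
  unfold L Rs R1 R2 R3 G; fun_prop

theorem Rs_eq (m : ℕ) (p : Fin 6 → ℝ) : Rs m p =
    (4 - (p 3) ^ 2 / 2) * (p 4) ^ 2
      + m * (p 5 * (4 * (m + 2) * p 4 - (1 + (p 3) ^ 2 / 4) * p 5)) := by
  unfold Rs R1 R2 R3; ring

theorem dim_mul_L (m : ℕ) (p : Fin 6 → ℝ) : (4 * (m : ℝ) + 2) * L m p = G m p + Rs m p - 1 := by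
  unfold L; field_simp

theorem R3_nonneg {m : ℕ} {p : Fin 6 → ℝ} (hY : p ∈ setP) (h3 : (p 3) ^ 2 ≤ 2)
    (hD : 0 ≤ 2 * p 4 - p 5) : 0 ≤ R3 m p := by
  obtain ⟨-, h4, h5⟩ := hY
  have h : R3 m p = p 5 * ((m + 2) * p 4 - ((p 3) ^ 2 / 8 + 1 / 2) * p 5) := by
    unfold R3; ring
  rw [h]
  refine mul_nonneg h5 ?_
  have hm : (0 : ℝ) ≤ m := m.cast_nonneg
  nlinarith [mul_nonneg hm h4, mul_nonneg (sub_nonneg.2 h3) h5]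

/-- The coupling coefficient of `2Y₂ - Y₃` in the derivative of
`(√2/2)(2Y₂ - Y₃) + X₃ - X₂`. -/
def coupling (m : ℕ) (p : Fin 6 → ℝ) : ℝ :=
  √2 / 2 * (1 - p 1) - p 4 + ((m : ℝ) - 1) / 2 * p 5 + (p 3) ^ 2 * (2 * p 4 + p 5) / 8

theorem coupling_nonneg {m : ℕ} (hm : 1 ≤ m) {p : Fin 6 → ℝ} (hE : G m p + Rs m p ≤ 1)
    (hY : p ∈ setP) (h3 : (p 3) ^ 2 ≤ 2) (hD : 0 ≤ 2 * p 4 - p 5) : 0 ≤ coupling m p := by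
  obtain ⟨-, h4, h5⟩ := hY
  have hm : (1 : ℝ) ≤ m := by exact_mod_cast hm
  have hs : √2 ^ 2 = 2 := Real.sq_sqrt (by norm_num)
  have hs0 : 0 ≤ √2 := Real.sqrt_nonneg 2
  have ht := sq_nonneg (p 3)
  have hRs : (4 - (p 3) ^ 2 / 2) * (p 4) ^ 2 ≤ Rs m p := by
    rw [Rs_eq]
    have : 0 ≤ (m : ℝ) * (p 5 * (4 * (m + 2) * p 4 - (1 + (p 3) ^ 2 / 4) * p 5)) := by
      refine mul_nonneg (by linarith) (mul_nonneg h5 ?_)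
      nlinarith [mul_nonneg (sub_nonneg.2 hm) h4, mul_nonneg (sub_nonneg.2 h3) h5]
    linarith
  have hG : 2 * (p 1) ^ 2 ≤ G m p := by
    unfold G
    have : 0 ≤ 4 * (m : ℝ) * (p 2) ^ 2 := by positivity
    nlinarith [sq_nonneg (p 0)]
  have h4sq := sq_nonneg (p 4)
  have hbound : (4 - (p 3) ^ 2 / 2) * (p 4) ^ 2 + 2 * (p 1) ^ 2 ≤ 1 := by linarith
  have hX : p 1 ≤ 1 := by nlinarith [mul_nonneg (sub_nonneg.2 h3) h4sq]
  have hmain : p 4 * (1 - (p 3) ^ 2 / 4) ≤ √2 / 2 * (1 - p 1) := by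
    refine (abs_le_of_sq_le_sq' ?_ (mul_nonneg (by positivity) (by linarith))).2
    have e1 : (√2 / 2 * (1 - p 1)) ^ 2 = (1 - p 1) ^ 2 / 2 := by
      rw [mul_pow, div_pow, hs]; ring
    have e2 : (p 4 * (1 - (p 3) ^ 2 / 4)) ^ 2 ≤ (p 4) ^ 2 * (1 - (p 3) ^ 2 / 8) := by
      rw [mul_pow]
      refine mul_le_mul_of_nonneg_left ?_ h4sq
      nlinarith
    nlinarith [sq_nonneg (2 * p 1 - 1)]
  unfold coupling
  have : 0 ≤ ((m : ℝ) - 1) / 2 * p 5 := mul_nonneg (by linarith) h5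
  nlinarith [mul_nonneg ht h5]

theorem stmt6 (m : ℕ) (hm : 1 ≤ m) (I : Set ℝ) (hI : I.OrdConnected)
    (c : ℝ → Fin 6 → ℝ) (hc : IsSolution m I c)
    (η₀ η₁ : ℝ) (hη₀ : η₀ ∈ I) (hη₁ : η₁ ∈ I) (hle : η₀ ≤ η₁)
    (h0 : c η₀ ∈ setS m) :
    c η₁ ∈ setS m := by
  have hsub : Icc η₀ η₁ ⊆ I := hI.out hη₀ hη₁
  have hd : ∀ t ∈ Icc η₀ η₁, ∀ i,
      HasDerivWithinAt (fun s => c s i) (V m (c t) i) (Icc η₀ η₁) t := fun t ht =>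
    hasDerivWithinAt_pi.1 ((hc t (hsub ht)).mono hsub)
  have hd0 := fun t ht => hd t ht 0
  have hd1 := fun t ht => hd t ht 1
  have hd2 := fun t ht => hd t ht 2
  have hd3 := fun t ht => hd t ht 3
  have hd4 := fun t ht => hd t ht 4
  have hd5 := fun t ht => hd t ht 5
  simp only [V, Matrix.cons_val] at hd0 hd1 hd2 hd3 hd4 hd5
  have hcont : ContinuousOn c (Icc η₀ η₁) := fun t ht =>
    ((hc t (hsub ht)).mono hsub).continuousWithinAt
  have hcoef : ∀ {F : (Fin 6 → ℝ) → ℝ}, Continuous F →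
      ContinuousOn (fun t => F (c t)) (Icc η₀ η₁) := fun hF => hF.comp_continuousOn hcont
  have hGc := continuous_G m
  have hLc := continuous_L m
  have hm0 : (1 : ℝ) ≤ m := by exact_mod_cast hm
  have hs : √2 ^ 2 = 2 := Real.sq_sqrt (by norm_num)
  obtain ⟨⟨⟨⟨hH0, hQ0⟩, hY30, hY40, hY50⟩, hu0, hw0⟩, hD0, hE0, hZ0, hX0⟩ := h0
  have hHd : ∀ t ∈ Icc η₀ η₁, HasDerivWithinAt
      (fun s => c s 0 + 2 * c s 1 + 4 * (m : ℝ) * c s 2 - 1)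
      ((G m (c t) + L m (c t) - 1) * (c t 0 + 2 * c t 1 + 4 * (m : ℝ) * c t 2 - 1))
      (Icc η₀ η₁) t := by
    intro t ht
    refine ((((hd0 t ht).add ((hd1 t ht).const_mul 2)).add
      ((hd2 t ht).const_mul (4 * (m : ℝ)))).sub_const 1).congr_deriv ?_
    have hL := dim_mul_L m (c t)
    simp only [Rs] at hL
    linear_combination -hL
  have hH : ∀ t ∈ Icc η₀ η₁, c t 0 + 2 * c t 1 + 4 * (m : ℝ) * c t 2 = 1 := by
    intro t ht
    have h1 := nonneg_of_mul_le_deriv hHd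
      (hcoef (F := fun p => G m p + L m p - 1) (by fun_prop)) (fun _ _ => le_rfl)
      (by linarith) t ht
    have h2 := nonneg_of_mul_le_deriv (fun t ht => (hHd t ht).neg)
      (hcoef (F := fun p => G m p + L m p - 1) (by fun_prop))
      (fun t _ => by simp only [Pi.neg_apply]; linarith)
      (by simp only [Pi.neg_apply]; linarith) t ht
    simp only [Pi.neg_apply] at h2
    linarith
  have hQ : ∀ t ∈ Icc η₀ η₁, 0 ≤ 1 - (G m (c t) + Rs m (c t)) := by
    refine nonneg_of_mul_le_deriv
      (f' := fun t => 2 * (G m (c t) + L m (c t)) * (1 - (G m (c t) + Rs m (c t)))) ?_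
      (hcoef (F := fun p => 2 * (G m p + L m p)) (by fun_prop)) (fun _ _ => le_rfl)
      (by linarith)
    intro t ht
    have dG := (((hd0 t ht).pow 2).add (((hd1 t ht).pow 2).const_mul 2)).add
      (((hd2 t ht).pow 2).const_mul (4 * (m : ℝ)))
    have d3 := (hd3 t ht).pow 2
    have d4 := (hd4 t ht).pow 2
    have d5 := (hd5 t ht).pow 2
    have dR := (((d3.div_const 2).const_sub 4).mul d4).add (((hd5 t ht).mul
      (((hd4 t ht).const_mul (4 * ((m : ℝ) + 2))).sub
        (((d3.div_const 4).const_add 1).mul (hd5 t ht)))).const_mul (m : ℝ))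
    have dQ := (dG.add dR).const_sub 1
    refine (dQ.congr_deriv ?_).congr_of_mem (fun s _ => ?_) ht
    · have e := hH t ht
      simp only [Pi.mul_apply, Pi.sub_apply, Pi.pow_apply]
      generalize hL : L m (c t) = l
      simp only [Rs, R1, R2, R3, G]
      linear_combination (2 * l) * e
    · rw [Rs_eq]; rfl
  have hY3 : ∀ t ∈ Icc η₀ η₁, 0 ≤ c t 3 :=
    nonneg_of_mul_le_deriv hd3 (hcoef (F := fun p => p 0 - p 1) (by fun_prop))
      (fun _ _ => (mul_comm _ _).le) hY30
  have hY4 : ∀ t ∈ Icc η₀ η₁, 0 ≤ c t 4 :=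
    nonneg_of_mul_le_deriv hd4 (hcoef (F := fun p => G m p + L m p - p 1) (by fun_prop))
      (fun _ _ => (mul_comm _ _).le) hY40
  have hY5 : ∀ t ∈ Icc η₀ η₁, 0 ≤ c t 5 :=
    nonneg_of_mul_le_deriv hd5
      (hcoef (F := fun p => G m p + L m p + p 1 - 2 * p 2) (by fun_prop))
      (fun _ _ => (mul_comm _ _).le) hY50
  have hA1 : ∀ t ∈ Icc η₀ η₁, 0 ≤ c t 1 - c t 0 ∧ 0 ≤ 2 - (c t 3) ^ 2 := by
    refine nonneg_of_cooperative (fun t ht => (hd1 t ht).sub (hd0 t ht))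
      (fun t ht => ((hd3 t ht).pow 2).const_sub 2)
      (hcoef (F := fun p => G m p + L m p - 1) (by fun_prop))
      (hcoef (F := fun p => (p 4) ^ 2 + (m : ℝ) / 4 * (p 5) ^ 2) (by fun_prop))
      (hcoef (F := fun p => 2 * (p 3) ^ 2) (by fun_prop))
      (hcoef (F := fun _ => 0) (by fun_prop))
      (fun t _ => by positivity) (fun t _ _ => by positivity) ?_ ?_
      (sub_nonneg.2 hu0) (sub_nonneg.2 hw0)
    · intro t _
      refine le_of_eq ?_
      simp only [R1, R2]
      ring
    · intro t _
      refine le_of_eq ?_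
      norm_num
      ring
  have hDE : ∀ t ∈ Icc η₀ η₁, 0 ≤ 2 * c t 4 - c t 5 ∧
      0 ≤ √2 / 2 * (2 * c t 4 - c t 5) + c t 2 - c t 1 := by
    have dD := fun t ht => ((hd4 t ht).const_mul 2).sub (hd5 t ht)
    refine nonneg_of_cooperative dD
      (fun t ht => (((dD t ht).const_mul (√2 / 2)).add (hd2 t ht)).sub (hd1 t ht))
      (hcoef (F := fun p => G m p + L m p - p 1 - √2 * p 5) (by fun_prop))
      (hcoef (F := fun p => 2 * p 5) (by fun_prop))
      (hcoef (F := coupling m) (by unfold coupling; fun_prop))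
      (hcoef (F := fun p => G m p + L m p - 1 + √2 * p 5) (by fun_prop))
      (fun t ht => by linarith [hY5 t ht])
      (fun t ht hD => coupling_nonneg hm (by linarith [hQ t ht])
        ⟨hY3 t ht, hY4 t ht, hY5 t ht⟩ (by linarith [(hA1 t ht).2]) hD) ?_ ?_ hD0 hE0
    · intro t _
      refine le_of_eq ?_
      ring
    · intro t _
      refine le_of_eq ?_
      simp only [coupling, R2, R3]
      linear_combination (c t 5 * (2 * c t 4 - c t 5) / 2) * hs
  have hR3 : ∀ t ∈ Icc η₀ η₁, 0 ≤ R3 m (c t) := fun t ht =>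
    R3_nonneg ⟨hY3 t ht, hY4 t ht, hY5 t ht⟩ (by linarith [(hA1 t ht).2]) (hDE t ht).1
  have hLn : ∀ t ∈ Icc η₀ η₁, L m (c t) ≤ 0 := fun t ht =>
    div_nonpos_of_nonpos_of_nonneg (by linarith [hQ t ht]) (by positivity)
  have hZ : ∀ t ∈ Icc η₀ η₁, 0 ≤ 1 / 2 - c t 1 := by
    refine nonneg_of_mul_le_deriv (fun t ht => (hd1 t ht).const_sub (1 / 2))
      (hcoef (F := fun p => G m p + L m p - 1) (by fun_prop)) ?_ (by linarith)
    intro t ht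
    have hL := dim_mul_L m (c t)
    simp only [Rs] at hL
    have h1 : 0 ≤ R1 m (c t) := by unfold R1; positivity
    have h2 := mul_nonneg (zero_le_one.trans hm0) (hR3 t ht)
    have h3 := mul_nonneg (zero_le_one.trans hm0) (neg_nonneg.2 (hLn t ht))
    linarith [hLn t ht]
  have hX : ∀ t ∈ Icc η₀ η₁, 0 ≤ c t 2 := by
    refine nonneg_of_mul_le_deriv hd2
      (hcoef (F := fun p => G m p + L m p - 1) (by fun_prop)) ?_ hX0
    intro t ht
    linarith [hR3 t ht, hLn t ht]
  have ht : η₁ ∈ Icc η₀ η₁ := right_mem_Icc.2 hle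
  exact ⟨⟨⟨⟨hH _ ht, by linarith [hQ _ ht]⟩, hY3 _ ht, hY4 _ ht, hY5 _ ht⟩,
    by linarith [(hA1 _ ht).1], by linarith [(hA1 _ ht).2]⟩,
    (hDE _ ht).1, (hDE _ ht).2, by linarith [hZ _ ht], hX _ ht⟩

end
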